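/- If ε ≡ 2 (mod 4), then there exist infinitely many positive odd integers n such that (n²+1)/2 has two positive divisors d₁, d₂ with d₁ + d₂ = 4n + ε. -/

import Mathlib

/-- The state carried along the Pell orbit. -/
def PellState (ε k d n a b : ℤ) : Prop :=
  0 < n ∧ Odd n ∧ 0 < a ∧ a ≤ b ∧ d * (a + b) = 4 * n + ε ∧
    2 * k * d * a * b = n ^ 2 + 1 ∧ 0 < 2 * k * (a + b) - n

theorem PellState.step {ε k d n a b p w : ℤ} (h : PellState ε k d n a b)
    (hk : 0 < k) (hd : 0 < d) (hN : 0 < k * (16 * k - 2 * d)) (hp : 0 < p) (hw : 0 < w)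
    (hpell : p ^ 2 - k * (16 * k - 2 * d) * w ^ 2 = 1) :
    ∃ n' a' b', PellState ε k d n' a' b' ∧ n < n' := by
  obtain ⟨hn, hodd, ha, hab, h1, h2, hy⟩ := h
  obtain ⟨y, hyd⟩ : ∃ y, y = 2 * k * (a + b) - n := ⟨_, rfl⟩
  obtain ⟨x, hxd⟩ : ∃ x, x = b - a := ⟨_, rfl⟩
  obtain ⟨N, hNd⟩ : ∃ N, N = k * (16 * k - 2 * d) := ⟨_, rfl⟩
  rw [← hyd] at hy
  rw [← hNd] at hN hpell
  have hx : 0 ≤ x := by omega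
  obtain ⟨t, ht⟩ : ∃ t, t = 2 * k * w ^ 2 * y + k * p * w * x := ⟨_, rfl⟩
  obtain ⟨s, hs⟩ : ∃ s, s = N * w ^ 2 * x + 2 * p * w * y := ⟨_, rfl⟩
  have htpos : 0 < t := by rw [ht]; positivity
  have hspos : 0 < s := by rw [hs]; positivity
  have heq : 2 * k * d * (a + 4 * t - s) * (b + 4 * t + s) = (n + 2 * d * t) ^ 2 + 1 := by
    have e : 2 * k * d * (a + 4 * t - s) * (b + 4 * t + s) - (n + 2 * d * t) ^ 2
        - (2 * k * d * a * b - n ^ 2) = 0 := by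
      have e1 : 2 * k * d * (a + 4 * t - s) * (b + 4 * t + s) - (n + 2 * d * t) ^ 2
        - (2 * k * d * a * b - n ^ 2)
        = 2 * d * (2 * t * y - k * x * s + k * 16 * t ^ 2 - k * s ^ 2 - 2 * d * t ^ 2) := by rw [hyd, hxd]; ring
      rw [e1]
      have hp2 : p ^ 2 = 1 + N * w ^ 2 := by linarith
      have e2 : k * (2 * t * y - k * x * s + k * 16 * t ^ 2 - k * s ^ 2 - 2 * d * t ^ 2) = 0 := by
        have : k * (2 * t * y - k * x * s + k * 16 * t ^ 2 - k * s ^ 2 - 2 * d * t ^ 2)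
          = 2 * k * t * y - k ^ 2 * x * s + N * t ^ 2 - k ^ 2 * s ^ 2 := by rw [hNd]; ring
        rw [this, ht, hs]
        linear_combination (N * k ^ 2 * w ^ 2 * x ^ 2 - 4 * k ^ 2 * w ^ 2 * y ^ 2) * hp2
      have := (mul_eq_zero.mp e2).resolve_left hk.ne'
      rw [this, mul_zero]
    linarith
  have hbpos : 0 < b + 4 * t + s := by linarith
  refine ⟨n + 2 * d * t, a + 4 * t - s, b + 4 * t + s, ⟨by positivity, ?_, ?_, by linarith, ?_, heq, ?_⟩, ?_⟩
  · rw [mul_assoc]; exact hodd.add_even (even_two_mul _)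
  · have : 0 < (2 * k * d * (b + 4 * t + s)) * (a + 4 * t - s) := by
      have : 0 < (n + 2 * d * t) ^ 2 + 1 := by positivity
      linarith
    exact pos_of_mul_pos_right this (by positivity)
  · linear_combination h1
  · have : 2 * k * (a + 4 * t - s + (b + 4 * t + s)) - (n + 2 * d * t)
        = y + 2 * N * w ^ 2 * y + N * p * w * x := by
      rw [ht, hNd, hyd, hxd]; ring
    rw [this]; positivity
  · have : 0 < d * t := by positivity
    linarith

theorem PellState.infinite {ε k d n a b : ℤ} (h : PellState ε k d n a b)
    (hk : 0 < k) (hd : 0 < d) (hko : k % 2 = 1) (hdo : d % 2 = 1) (hN : 0 < 8 * k - d) :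
    {n : ℤ | 0 < n ∧ Odd n ∧ ∃ d₁ d₂ : ℤ, 0 < d₁ ∧ 0 < d₂ ∧
      d₁ ∣ (n ^ 2 + 1) / 2 ∧ d₂ ∣ (n ^ 2 + 1) / 2 ∧ d₁ + d₂ = 4 * n + ε}.Infinite := by
  have hN' : 0 < k * (16 * k - 2 * d) := mul_pos hk (by linarith)
  have hsq : ¬ IsSquare (k * (16 * k - 2 * d)) := by
    rintro ⟨r, hr⟩
    obtain ⟨i, rfl⟩ : ∃ i, k = 2 * i + 1 := ⟨k / 2, by omega⟩
    obtain ⟨j, rfl⟩ : ∃ j, d = 2 * j + 1 := ⟨d / 2, by omega⟩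
    rcases Int.even_or_odd' r with ⟨c, rfl | rfl⟩ <;> ring_nf at hr <;> omega
  obtain ⟨p, w, hpw, hw⟩ := Pell.exists_of_not_isSquare hN' hsq
  have hpw' : |p| ^ 2 - k * (16 * k - 2 * d) * |w| ^ 2 = 1 := by simpa [sq_abs] using hpw
  have hp : p ≠ 0 := by
    rintro rfl
    nlinarith [sq_nonneg w, mul_nonneg hN'.le (sq_nonneg w)]
  have key : ∀ m : ℕ, ∃ n a b, PellState ε k d n a b ∧ (m : ℤ) < n := by
    intro m
    induction m with
    | zero => exact ⟨n, a, b, h, by simpa using h.1⟩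
    | succ m ih =>
      obtain ⟨n, a, b, hs, hm⟩ := ih
      obtain ⟨n', a', b', hs', hlt⟩ :=
        hs.step hk hd hN' (abs_pos.mpr hp) (abs_pos.mpr hw) hpw'
      exact ⟨n', a', b', hs', by push_cast; omega⟩
  refine Set.infinite_of_forall_exists_gt fun m => ?_
  obtain ⟨n, a, b, ⟨hn, hodd, ha, hab, h1, h2, -⟩, hm⟩ := key m.toNat
  have hb : 0 < b := by linarith
  have h3 : (n ^ 2 + 1) / 2 = k * d * a * b := by
    rw [← h2]
    have : 2 * k * d * a * b = 2 * (k * d * a * b) := by ring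
    omega
  refine ⟨n, ⟨hn, hodd, d * a, d * b, by positivity, by positivity, ?_, ?_, by linarith⟩, by omega⟩
  · rw [h3]; exact ⟨k * b, by ring⟩
  · rw [h3]; exact ⟨k * a, by ring⟩

/-- If `ε ≡ 2 (mod 4)`, then there exist infinitely many positive odd integers `n`
such that `(n²+1)/2` has two positive divisors `d₁, d₂` with `d₁ + d₂ = 4n + ε`. -/
theorem stmt1 (ε : ℤ) (hε : ε % 4 = 2) :
    {n : ℤ | 0 < n ∧ Odd n ∧ ∃ d₁ d₂ : ℤ, 0 < d₁ ∧ 0 < d₂ ∧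
      d₁ ∣ (n ^ 2 + 1) / 2 ∧ d₂ ∣ (n ^ 2 + 1) / 2 ∧ d₁ + d₂ = 4 * n + ε}.Infinite := by
  have hcase : (∃ j, ε = 8 * j + 2) ∨ ∃ j, ε = 8 * j + 6 := by
    have : ε % 8 = 2 ∨ ε % 8 = 6 := by omega
    rcases this with h | h
    · exact Or.inl ⟨ε / 8, by omega⟩
    · exact Or.inr ⟨ε / 8, by omega⟩
  rcases hcase with ⟨j, rfl⟩ | ⟨j, rfl⟩
  · have hq : 0 < 16 * j ^ 2 - 8 * j + 4 := by nlinarith [sq_nonneg (4 * j - 1)]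
    have hst : PellState (8 * j + 2) (8 * j ^ 4 + 4 * j ^ 2 + 1) (16 * j ^ 2 + 8 * j + 5)
        (64 * j ^ 4 + 28 * j ^ 2 + 7) 1 (16 * j ^ 2 - 8 * j + 5) := by
      refine ⟨by positivity, ⟨32 * j ^ 4 + 14 * j ^ 2 + 3, by ring⟩, by norm_num, by linarith,
        by ring, by ring, ?_⟩
      have hk : 0 < 8 * j ^ 4 + 4 * j ^ 2 + 1 := by positivity
      have := mul_pos hk hq
      nlinarith [mul_nonneg hk.le (sq_nonneg (4 * j - 1)), sq_nonneg j]
    refine hst.infinite (by positivity) (by nlinarith [sq_nonneg (4 * j + 1)]) (by omega)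
      (by omega) ?_
    nlinarith [sq_nonneg (4 * j - 1), sq_nonneg (j ^ 2)]
  · have hst : PellState (8 * j + 6) (2 * j ^ 2 + 2 * j + 1) 1
        (16 * j ^ 2 + 18 * j + 9) 1 (64 * j ^ 2 + 80 * j + 41) := by
      refine ⟨by nlinarith [sq_nonneg (16 * j + 9)], ⟨8 * j ^ 2 + 9 * j + 4, by ring⟩, by norm_num,
        by nlinarith [sq_nonneg (8 * j + 5)], by ring, by ring, ?_⟩
      have hk : 0 ≤ 2 * j ^ 2 + 2 * j := by
        rcases le_or_gt 0 j with h | h <;> nlinarith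
      have hB : 0 ≤ 64 * j ^ 2 + 80 * j + 41 := by nlinarith [sq_nonneg (8 * j + 5)]
      nlinarith [mul_nonneg hk hB, sq_nonneg (8 * j + 5)]
    have hk : 0 ≤ 2 * j ^ 2 + 2 * j := by
      rcases le_or_gt 0 j with h | h <;> nlinarith
    exact hst.infinite (by linarith) (by norm_num) (by omega) (by norm_num) (by linarith)
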